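/- Let A be an r×n integer matrix with columns a_1,…,a_n ∈ ℤ^r. Then there exist a natural number D and a nonzero polynomial H ∈ ℂ[c_1,…,c_n,u_1,…,u_n] such that for every (c,u) ∈ (ℂ*)^n × ℂ^n with H(c,u) ≠ 0 the likelihood system for (A,c,u) has exactly D solutions, and moreover for every fixed c ∈ (ℂ*)^n there is a nonzero polynomial G ∈ ℂ[u_1,…,u_n] such that for every u ∈ ℂ^n with G(u) ≠ 0 the likelihood system for (A,c,u) has at most D solutions (in particular finitely many). (That is, the ML degree of V^c is at most deg V for every c ∈ (ℂ*)^n, with equality for generic c.) -/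

import Mathlib

open scoped BigOperators

/-- The likelihood system for a matrix `A`, scaling `c` and data `u`. -/
def mlSolutions {κ ι : Type*} [Fintype κ] [Fintype ι] (A : κ → ι → ℤ)
    (c u : ι → ℂ) : Set (ι → ℂ) :=
  {p | (∀ j, p j ≠ 0) ∧
    (∀ v : ι → ℤ, (∀ i, ∑ j, A i j * v j = 0) → (∑ j, v j = 0) →
      (∏ j, p j ^ (max (v j) 0).toNat) = (∏ j, p j ^ (max (-v j) 0).toNat)) ∧
    (∑ j, c j * p j = 1) ∧
    (∀ i, (∑ j, u j) * (∑ j, (A i j : ℂ) * (c j * p j)) = ∑ j, (A i j : ℂ) * u j)}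

lemma exists_annihilating_polynomial {R S K L : Type*} [CommRing R] [IsDomain R] [CommRing S]
    [Field K] [Field L] [Algebra R S] [Algebra R K] [IsFractionRing R K] [Algebra S L]
    [FaithfulSMul S L] [Algebra K L] [Algebra R L] [IsScalarTower R K L] [IsScalarTower R S L]
    [FiniteDimensional K L] (g : S) :
    ∃ Q : Polynomial R, Q ≠ 0 ∧ Q.natDegree ≤ Module.finrank K L ∧ Polynomial.aeval g Q = 0 := by
  set p := minpoly K (algebraMap S L g) with hp
  have hp0 : p ≠ 0 := minpoly.ne_zero (Algebra.IsIntegral.isIntegral _)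
  obtain ⟨b, hb, hmap⟩ := IsLocalization.integerNormalization_spec (nonZeroDivisors R) p
  set Q := IsLocalization.integerNormalization (nonZeroDivisors R) p with hQ
  have hinj : Function.Injective (algebraMap R K) := IsFractionRing.injective R K
  have hb0 : algebraMap R K b ≠ 0 := by
    simpa using nonZeroDivisors.ne_zero hb
  have hmap' : Q.map (algebraMap R K) = Polynomial.C (algebraMap R K b) * p := by
    ext i
    simp [hmap, Algebra.smul_def]
  refine ⟨Q, ?_, ?_, ?_⟩
  · intro h
    rw [h, Polynomial.map_zero] at hmap'
    exact mul_ne_zero (Polynomial.C_ne_zero.2 hb0) hp0 hmap'.symm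
  · rw [← Polynomial.natDegree_map_eq_of_injective hinj Q, hmap', Polynomial.natDegree_C_mul hb0]
    exact minpoly.natDegree_le _
  · apply FaithfulSMul.algebraMap_injective S L
    rw [map_zero, ← Polynomial.aeval_algebraMap_apply, ← Polynomial.aeval_map_algebraMap K, hmap',
      map_mul, hp, minpoly.aeval, mul_zero]

universe u

lemma exists_denominator_lifts {R : Type u} {K : Type*} [CommRing R] [IsDomain R] [Field K]
    [Algebra R K] [IsFractionRing R K] (s : Finset (Polynomial K)) :
    ∃ h : R, h ≠ 0 ∧ ∀ (T : Type u) [CommRing T] [Algebra R T] [Algebra T K] [IsScalarTower R T K],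
      IsUnit (algebraMap R T h) → ∀ p ∈ s, p ∈ Polynomial.lifts (algebraMap T K) := by
  classical
  obtain ⟨⟨h, hh⟩, hspec⟩ := IsLocalization.exist_integer_multiples_of_finset (nonZeroDivisors R)
    (s.biUnion fun p => p.coeffs)
  refine ⟨h, nonZeroDivisors.ne_zero hh, fun T _ _ _ _ hu p hp => ?_⟩
  rw [Polynomial.lifts_iff_coeff_lifts]
  intro i
  by_cases hi : p.coeff i = 0
  · exact ⟨0, by simp [hi]⟩
  · obtain ⟨r, hr⟩ := hspec (p.coeff i)
      (Finset.mem_biUnion.2 ⟨p, hp, Polynomial.coeff_mem_coeffs hi⟩)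
    obtain ⟨u, hu⟩ := hu
    refine ⟨algebraMap R T r * ↑u⁻¹, ?_⟩
    have h1 : algebraMap T K ↑u * algebraMap T K ↑u⁻¹ = 1 := by
      rw [← map_mul, Units.mul_inv, map_one]
    rw [map_mul, ← IsScalarTower.algebraMap_apply R T K, hr]
    simp only [Algebra.smul_def]
    rw [IsScalarTower.algebraMap_apply R T K, ← hu, mul_right_comm, h1, one_mul]

lemma RingHom.exists_comp_eq_of_injective {A B C : Type*} [Ring A] [Ring B] [Ring C]
    (f : A →+* C) (j : B →+* C) (hj : Function.Injective j) (h : ∀ a, ∃ b, j b = f a) :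
    ∃ σ : A →+* B, ∀ a, j (σ a) = f a := by
  choose σ hσ using h
  exact ⟨{ toFun := σ
           map_one' := hj (by simp [hσ])
           map_zero' := hj (by simp [hσ])
           map_add' := fun _ _ => hj (by simp [hσ])
           map_mul' := fun _ _ => hj (by simp [hσ]) }, hσ⟩

lemma exists_specializations {R : Type u} {S K L F : Type*} [CommRing R] [IsDomain R] [CommRing S]
    [Field K] [Field L] [Field F] [IsAlgClosed F] [CharZero K]
    [Algebra R S] [Algebra R K] [IsFractionRing R K] [Algebra S L]
    [IsDomain S] [IsFractionRing S L] [Algebra K L] [Algebra R L] [IsScalarTower R K L]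
    [IsScalarTower R S L] [FiniteDimensional K L] [Algebra.FiniteType R S] :
    ∃ h : R, h ≠ 0 ∧ ∀ x : R →+* F, x h ≠ 0 → ∃ s : Finset (S →+* F),
      s.card = Module.finrank K L ∧ ∀ χ ∈ s, χ.comp (algebraMap R S) = x := by
  classical
  obtain ⟨g, hg⟩ := Field.exists_primitive_element K L
  obtain ⟨a, b, hb, hab⟩ := IsFractionRing.div_surjective (A := S) g
  have hb0 : algebraMap S L b ≠ 0 := by
    simpa using nonZeroDivisors.ne_zero hb
  have hint : IsIntegral K g := Algebra.IsIntegral.isIntegral g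
  have hsurj : ∀ y : L, ∃ p : Polynomial K, Polynomial.aeval g p = y := by
    intro y
    have h1 := IntermediateField.adjoin_simple_toSubalgebra_of_isAlgebraic (hint.isAlgebraic)
    rw [hg, IntermediateField.top_toSubalgebra, Algebra.adjoin_singleton_eq_range_aeval] at h1
    have : y ∈ (⊤ : Subalgebra K L) := trivial
    rw [h1] at this
    exact this
  choose rep hrep using hsurj
  set m := minpoly K g with hm
  obtain ⟨e₁, e₂, he⟩ := (Algebra.IsSeparable.isSeparable K g : m.Separable)
  obtain ⟨gens, hgens⟩ := Algebra.FiniteType.out (R := R) (A := S)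
  obtain ⟨h, hh0, hlift⟩ := exists_denominator_lifts (R := R)
    ({m, e₁, e₂, rep (algebraMap S L b)⁻¹} ∪ gens.image fun y => rep (algebraMap S L y))
  refine ⟨h, hh0, fun x hx => ?_⟩
  let T := Localization.Away h
  have hK : IsUnit (algebraMap R K h) := by
    simpa using hh0
  let ι : T →+* K := IsLocalization.Away.lift h hK
  let _ : Algebra T K := ι.toAlgebra
  have htow : IsScalarTower R T K := IsScalarTower.of_algebraMap_eq fun r => by
    simp [T, ι, RingHom.algebraMap_toAlgebra]
  have hιR : ∀ r, ι (algebraMap R T r) = algebraMap R K r := fun r => by simp [T, ι]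
  have hιinj : Function.Injective ι := by
    rw [injective_iff_map_eq_zero]
    intro t ht
    obtain ⟨⟨r, d⟩, hrd⟩ := IsLocalization.surj (Submonoid.powers h) t
    have hd : IsUnit (algebraMap R T d) := IsLocalization.map_units T d
    have h1 : algebraMap R K r = 0 := by
      rw [← hιR, ← hrd, map_mul, ht, zero_mul]
    have h2 : r = 0 := by simpa using h1
    rw [h2, map_zero] at hrd
    exact hd.mul_left_eq_zero.1 hrd
  have hlift' := hlift T (IsLocalization.Away.algebraMap_isUnit h)
  have hmT := hlift' m (by simp)
  have he₁T := hlift' e₁ (by simp)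
  have he₂T := hlift' e₂ (by simp)
  obtain ⟨mT, hmT, hmTdeg, hmTmon⟩ :=
    Polynomial.lifts_and_natDegree_eq_and_monic hmT (minpoly.monic hint)
  obtain ⟨e₁T, he₁T⟩ := he₁T
  obtain ⟨e₂T, he₂T⟩ := he₂T
  change mT.map ι = m at hmT
  change e₁T.map ι = e₁ at he₁T
  change e₂T.map ι = e₂ at he₂T
  have hsep : mT.Separable := by
    refine ⟨e₁T, e₂T, Polynomial.map_injective ι hιinj ?_⟩
    simp only [Polynomial.map_add, Polynomial.map_mul, Polynomial.map_one, he₁T, he₂T, hmT,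
      ← Polynomial.derivative_map]
    exact he
  let y : T →+* F := IsLocalization.Away.lift h (g := x) (isUnit_iff_ne_zero.2 hx)
  have hy : ∀ r, y (algebraMap R T r) = x r := fun r => by simp [T, y]
  let j : AdjoinRoot mT →+* L := AdjoinRoot.lift ((algebraMap K L).comp ι) g (by
    rw [← Polynomial.eval₂_map, hmT]
    exact minpoly.aeval K g)
  have hj : ∀ p : Polynomial T, j (AdjoinRoot.mk mT p) = Polynomial.aeval g (p.map ι) := by
    intro p
    simp [j, Polynomial.aeval_def, Polynomial.eval₂_map]
  have hjinj : Function.Injective j := by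
    rw [injective_iff_map_eq_zero]
    intro z hz
    obtain ⟨p, rfl⟩ := AdjoinRoot.mk_surjective z
    rw [hj] at hz
    have := minpoly.dvd K g hz
    rw [← hm, ← hmT, Polynomial.map_dvd_map ι hιinj hmTmon] at this
    exact AdjoinRoot.mk_eq_zero.2 this
  have hjroot : j (AdjoinRoot.root mT) = g := by simp [j]
  have hjof : ∀ r, j (AdjoinRoot.of mT (algebraMap R T r)) = algebraMap R L r := by
    intro r
    simp [j, hιR, ← IsScalarTower.algebraMap_apply R K L]
  have hrange : ∀ z ∈ ({m, e₁, e₂, rep (algebraMap S L b)⁻¹} ∪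
      gens.image fun y => rep (algebraMap S L y)), ∃ w, j w = Polynomial.aeval g z := by
    intro z hz
    obtain ⟨p, hp⟩ := hlift' z hz
    exact ⟨AdjoinRoot.mk mT p, by rw [hj, ← hp]; rfl⟩
  obtain ⟨σ, hσ⟩ := RingHom.exists_comp_eq_of_injective (algebraMap S L) j hjinj (by
    intro z
    have hz : z ∈ Algebra.adjoin R (gens : Set S) := hgens ▸ trivial
    induction hz using Algebra.adjoin_induction with
    | mem z hz =>
      obtain ⟨w, hw⟩ := hrange (rep (algebraMap S L z)) (Finset.mem_union_right _
        (Finset.mem_image_of_mem (fun y => rep (algebraMap S L y)) hz))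
      exact ⟨w, by rw [hw, hrep]⟩
    | algebraMap r =>
      exact ⟨_, by rw [hjof, IsScalarTower.algebraMap_apply R S L]⟩
    | add z₁ z₂ _ _ h₁ h₂ =>
      obtain ⟨w₁, h₁⟩ := h₁
      obtain ⟨w₂, h₂⟩ := h₂
      exact ⟨w₁ + w₂, by simp [h₁, h₂]⟩
    | mul z₁ z₂ _ _ h₁ h₂ =>
      obtain ⟨w₁, h₁⟩ := h₁
      obtain ⟨w₂, h₂⟩ := h₂
      exact ⟨w₁ * w₂, by simp [h₁, h₂]⟩)
  obtain ⟨bi, hbi⟩ := hrange (rep (algebraMap S L b)⁻¹) (by simp)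
  rw [hrep] at hbi
  have hbbi : σ b * bi = 1 := hjinj (by rw [map_mul, hσ, hbi, map_one, mul_inv_cancel₀ hb0])
  have hbg : σ b * AdjoinRoot.root mT = σ a := hjinj (by
    rw [map_mul, hσ, hjroot, hσ, ← hab]
    field_simp)
  have hσR : ∀ r, σ (algebraMap R S r) = AdjoinRoot.of mT (algebraMap R T r) := fun r => hjinj (by
    rw [hσ, hjof, IsScalarTower.algebraMap_apply R S L])
  let χ : {ζ // ζ ∈ (mT.map y).roots.toFinset} → (S →+* F) := fun ζ =>
    (AdjoinRoot.lift y ζ.1 (by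
      have := ζ.2
      rw [Multiset.mem_toFinset, Polynomial.mem_roots (hmTmon.map y).ne_zero] at this
      rwa [Polynomial.IsRoot, Polynomial.eval_map] at this)).comp σ
  have hχinj : Function.Injective χ := by
    intro ζ ζ' hζ
    have key : ∀ ζ, (χ ζ) b ≠ 0 ∧ (χ ζ) b * ζ.1 = (χ ζ) a := by
      intro ζ
      refine ⟨fun h0 => ?_, ?_⟩
      · have := congrArg (AdjoinRoot.lift y ζ.1 (by
          have := ζ.2
          rw [Multiset.mem_toFinset, Polynomial.mem_roots (hmTmon.map y).ne_zero] at this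
          rwa [Polynomial.IsRoot, Polynomial.eval_map] at this)) hbbi
        rw [map_mul, map_one] at this
        change (χ ζ) b * _ = 1 at this
        rw [h0, zero_mul] at this
        exact zero_ne_one this
      · simp only [χ, RingHom.comp_apply, ← hbg, map_mul, AdjoinRoot.lift_root]
    have h1 := key ζ
    have h2 := key ζ'
    rw [← hζ] at h2
    exact Subtype.ext (mul_left_cancel₀ h1.1 (h1.2.trans h2.2.symm))
  refine ⟨Finset.univ.map ⟨χ, hχinj⟩, ?_, ?_⟩
  · rw [Finset.card_map, Finset.card_univ, Fintype.card_coe,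
      Multiset.toFinset_card_of_nodup (Polynomial.nodup_roots hsep.map),
      ← (IsAlgClosed.splits (mT.map y)).natDegree_eq_card_roots, hmTmon.natDegree_map, hmTdeg, hm,
      ← IntermediateField.adjoin.finrank hint, hg, IntermediateField.finrank_top']
  · intro c hc
    obtain ⟨ζ, -, rfl⟩ := Finset.mem_map.1 hc
    ext r
    simp [χ, hσR, hy]

lemma exists_generic_degree {σ S : Type} [Fintype σ] [CommRing S] [IsDomain S] [Algebra ℂ S]
    [Algebra.FiniteType ℂ S] (htr : Algebra.trdeg ℂ S ≤ Cardinal.mk σ)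
    (φ : MvPolynomial σ ℂ →ₐ[ℂ] S) :
    ∃ D : ℕ,
      (∀ g : S, ∃ Q : Polynomial (MvPolynomial σ ℂ), Q ≠ 0 ∧ Q.natDegree ≤ D ∧
        Q.eval₂ (φ : MvPolynomial σ ℂ →+* S) g = 0) ∧
      ∃ h : MvPolynomial σ ℂ, h ≠ 0 ∧ ∀ x : MvPolynomial σ ℂ →+* ℂ, x h ≠ 0 →
        ∃ s : Finset (S →+* ℂ), s.card = D ∧
          ∀ χ ∈ s, χ.comp (φ : MvPolynomial σ ℂ →+* S) = x := by
  by_cases hφ : Function.Injective φ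
  · let _ : Algebra (MvPolynomial σ ℂ) S := (φ : MvPolynomial σ ℂ →+* S).toAlgebra
    have : IsScalarTower ℂ (MvPolynomial σ ℂ) S := IsScalarTower.of_algHom φ
    have : FaithfulSMul (MvPolynomial σ ℂ) S := (faithfulSMul_iff_algebraMap_injective _ _).2 hφ
    have : FaithfulSMul ℂ S := .trans ℂ (MvPolynomial σ ℂ) S
    have halg : Algebra.IsAlgebraic (MvPolynomial σ ℂ) S := by
      rw [← trdeg_eq_zero_iff]
      have h := trdeg_add_eq ℂ (MvPolynomial σ ℂ) (A := S)
      rw [MvPolynomial.trdeg_of_isDomain, Cardinal.lift_id] at h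
      have hle : Cardinal.mk σ + Algebra.trdeg (MvPolynomial σ ℂ) S ≤ Cardinal.mk σ + 0 := by
        rw [h, add_zero]; exact htr
      rw [add_comm, add_comm (Cardinal.mk σ) 0] at hle
      have := (Cardinal.add_le_add_iff_of_lt_aleph0 (Cardinal.mk_lt_aleph0 (α := σ))).1 hle
      exact nonpos_iff_eq_zero.1 this
    have : Algebra.FiniteType (MvPolynomial σ ℂ) S :=
      Algebra.FiniteType.of_restrictScalars_finiteType ℂ _ _
    let K := FractionRing (MvPolynomial σ ℂ)
    let L := FractionRing S
    have : FaithfulSMul (MvPolynomial σ ℂ) L := .trans _ S _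
    let _ : Algebra K L := FractionRing.liftAlgebra (MvPolynomial σ ℂ) L
    have : IsScalarTower (MvPolynomial σ ℂ) K L :=
      FractionRing.isScalarTower_liftAlgebra (MvPolynomial σ ℂ) L
    have : Algebra.IsAlgebraic (MvPolynomial σ ℂ) L :=
      (IsFractionRing.isAlgebraic_iff' (MvPolynomial σ ℂ) S L).1 halg
    have : Algebra.IsAlgebraic K L :=
      (IsFractionRing.comap_isAlgebraic_iff (A := MvPolynomial σ ℂ)).1 this
    have : Algebra.EssFiniteType (MvPolynomial σ ℂ) L := Algebra.EssFiniteType.comp _ S _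
    have : Algebra.EssFiniteType K L := Algebra.EssFiniteType.of_comp (MvPolynomial σ ℂ) K L
    have : FiniteDimensional K L := Algebra.finite_of_essFiniteType_of_isAlgebraic
    have : CharZero K := charZero_of_injective_algebraMap
      (IsFractionRing.injective (MvPolynomial σ ℂ) K)
    exact ⟨Module.finrank K L, fun g => exists_annihilating_polynomial (K := K) (L := L) g,
      exists_specializations (K := K) (L := L)⟩
  · rw [injective_iff_map_eq_zero] at hφ
    push Not at hφ
    obtain ⟨P, hP, hP0⟩ := hφ
    refine ⟨0, fun g => ⟨Polynomial.C P, by simpa using hP0, by simp, by simpa using hP⟩, 1, by simp,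
      fun _ _ => ⟨∅, by simp, by simp⟩⟩

lemma Polynomial.exists_eq_pow_mul_map_eval_zero_ne_zero {A : Type*} [CommRing A] [IsDomain A]
    [UniqueFactorizationMonoid A] {Q : Polynomial (Polynomial A)} (hQ : Q ≠ 0) :
    ∃ (k : ℕ) (Q' : Polynomial (Polynomial A)), Q = Polynomial.C Polynomial.X ^ k * Q' ∧
      Q'.map (Polynomial.evalRingHom 0) ≠ 0 := by
  have hirr : Irreducible (Polynomial.C (Polynomial.X : Polynomial A)) :=
    (Polynomial.prime_C_iff.2 Polynomial.prime_X).irreducible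
  obtain ⟨k, Q', hdvd, rfl⟩ := WfDvdMonoid.max_power_factor hQ hirr
  refine ⟨k, Q', rfl, fun h => hdvd ?_⟩
  rw [Polynomial.C_dvd_iff_dvd_coeff]
  intro i
  rw [Polynomial.X_dvd_iff, Polynomial.coeff_zero_eq_eval_zero]
  simpa using congrArg (fun p => p.coeff i) h

open Filter Topology in
lemma exists_specialized_polynomial {α β : Type*} [Fintype α] [Fintype β]
    {Q : Polynomial (MvPolynomial (α ⊕ β) ℂ)} (hQ : Q ≠ 0) (c₀ : α → ℂ) :
    ∃ Q₀ : Polynomial (MvPolynomial β ℂ), Q₀ ≠ 0 ∧ Q₀.natDegree ≤ Q.natDegree ∧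
      ∀ (W : (α → ℂ) → (β → ℂ)) (g : ℂ), ContinuousAt W c₀ →
        (∀ᶠ c in 𝓝 c₀, (Q.map (MvPolynomial.eval (Sum.elim c (W c)))).eval g = 0) →
        (Q₀.map (MvPolynomial.eval (W c₀))).eval g = 0 := by
  obtain ⟨z, hz⟩ : ∃ z, MvPolynomial.eval z Q.leadingCoeff ≠ 0 := by
    by_contra! h
    exact Polynomial.leadingCoeff_ne_zero.2 hQ (MvPolynomial.funext fun z => by simp [h z])
  let ψ : MvPolynomial (α ⊕ β) ℂ →+* Polynomial (MvPolynomial β ℂ) :=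
    MvPolynomial.eval₂Hom (Polynomial.C.comp MvPolynomial.C) (Sum.elim
      (fun a => Polynomial.C (MvPolynomial.C (c₀ a)) +
        Polynomial.X * Polynomial.C (MvPolynomial.C (z (Sum.inl a) - c₀ a)))
      (fun b => Polynomial.C (MvPolynomial.X b)))
  let e (ε : ℂ) (w : β → ℂ) : Polynomial (MvPolynomial β ℂ) →+* ℂ :=
    Polynomial.eval₂RingHom (MvPolynomial.eval w) ε
  let γ (ε : ℂ) : α → ℂ := fun a => c₀ a + ε * (z (Sum.inl a) - c₀ a)
  have heψ : ∀ ε w, (e ε w).comp ψ = MvPolynomial.eval (Sum.elim (γ ε) w) := by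
    intro ε w
    refine MvPolynomial.ringHom_ext (fun r => by simp [e, ψ]) ?_
    rintro (a | b) <;> simp [e, ψ, γ]
  have hψQ : Q.map ψ ≠ 0 := by
    intro h
    have h1 := congrArg (fun p => e 1 (fun b => z (Sum.inr b)) (p.coeff Q.natDegree)) h
    simp only [Polynomial.coeff_map, Polynomial.coeff_zero, map_zero] at h1
    rw [← RingHom.comp_apply, heψ] at h1
    have hz1 : Sum.elim (γ 1) (fun b => z (Sum.inr b)) = z := by
      ext (a | b) <;> simp [γ]
    rw [hz1] at h1
    exact hz h1
  obtain ⟨k, Q', hQ', hne⟩ := Polynomial.exists_eq_pow_mul_map_eval_zero_ne_zero hψQ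
  have hdeg : Q'.natDegree ≤ Q.natDegree := by
    have h1 : (Q.map ψ).natDegree = Q'.natDegree := by
      rw [hQ', ← Polynomial.C_pow, Polynomial.natDegree_C_mul (pow_ne_zero _ Polynomial.X_ne_zero)]
    rw [← h1]
    exact Polynomial.natDegree_map_le
  refine ⟨_, hne, Polynomial.natDegree_map_le.trans hdeg, fun W g hW hev => ?_⟩
  have hγ : Continuous γ := by fun_prop
  have hγ0 : γ 0 = c₀ := by ext; simp [γ]
  let f (ε : ℂ) : ℂ := (Q'.map (e ε (W (γ ε)))).eval g
  have hf : ContinuousAt f 0 := by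
    have hcont : Continuous fun v : ℂ × (β → ℂ) => (Q'.map (e v.1 v.2)).eval g := by
      simp only [Polynomial.eval_map, Polynomial.eval₂_eq_sum_range, e, Polynomial.coe_eval₂RingHom]
      refine continuous_finsetSum _ fun i _ => Continuous.mul
        (continuous_finsetSum _ fun l _ => Continuous.mul ?_ (by fun_prop)) (by fun_prop)
      exact (MvPolynomial.continuous_eval _).comp continuous_snd
    have hW' : ContinuousAt W (γ 0) := by rwa [hγ0]
    exact hcont.continuousAt.comp
      (f := fun ε => (ε, W (γ ε))) (x := 0) (continuousAt_id.prodMk (hW'.comp hγ.continuousAt))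
  have hzero : ∀ᶠ ε in 𝓝[≠] (0 : ℂ), f ε = 0 := by
    have h1 : ∀ᶠ ε in 𝓝 (0 : ℂ), (Q.map (MvPolynomial.eval
        (Sum.elim (γ ε) (W (γ ε))))).eval g = 0 :=
      hγ.continuousAt.eventually (by rwa [hγ0])
    filter_upwards [h1.filter_mono nhdsWithin_le_nhds, self_mem_nhdsWithin] with ε hε hne
    rw [← heψ, ← Polynomial.map_map, hQ'] at hε
    simp only [Polynomial.map_mul, Polynomial.map_pow, Polynomial.map_C, Polynomial.eval_mul,
      Polynomial.eval_pow, Polynomial.eval_C, mul_eq_zero] at hε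
    refine hε.resolve_left (pow_ne_zero _ ?_)
    simpa [e] using hne
  have hf0 : f 0 = 0 := tendsto_nhds_unique (hf.tendsto.mono_left nhdsWithin_le_nhds)
    (tendsto_const_nhds.congr' (hzero.mono fun _ h => h.symm))
  have he0 : (MvPolynomial.eval (W c₀)).comp (Polynomial.evalRingHom 0) = e 0 (W (γ 0)) :=
    Polynomial.ringHom_ext (fun p => by simp [e, hγ0]) (by simp [e])
  rw [Polynomial.map_map, he0]
  exact hf0

lemma exists_injOn_sum_pow_mul {d N : ℕ} (s : Finset (Fin d → ℂ)) (hs : s.card ≤ N) :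
    ∃ k ∈ Finset.range (N * N * d + 1),
      Set.InjOn (fun t : Fin d → ℂ => ∑ i : Fin d, (k : ℂ) ^ (i : ℕ) * t i) s := by
  classical
  let R (v : Fin d → ℂ) : Polynomial ℂ := ∑ i : Fin d, Polynomial.monomial (i : ℕ) (v i)
  have hcoeff : ∀ v (i : Fin d), (R v).coeff (i : ℕ) = v i := by
    intro v i
    simp [R, Polynomial.coeff_monomial, Fin.val_inj]
  have hdeg : ∀ v, (R v).natDegree ≤ d := fun v => Polynomial.natDegree_sum_le_of_forall_le _ _
    fun i _ => (Polynomial.natDegree_monomial_le _).trans i.2.le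
  have heval : ∀ v x, (R v).eval x = ∑ i : Fin d, x ^ (i : ℕ) * v i := by
    intro v x
    simp [R, Polynomial.eval_finsetSum, mul_comm]
  let bad : Finset ℂ := (s ×ˢ s).biUnion fun p => (R (p.1 - p.2)).roots.toFinset
  have hbad : bad.card ≤ N * N * d := by
    refine (Finset.card_biUnion_le_card_mul _ _ d fun p _ =>
      (Multiset.toFinset_card_le _).trans ((Polynomial.card_roots' _).trans (hdeg _))).trans ?_
    rw [Finset.card_product]
    gcongr
  obtain ⟨x, hx, hxb⟩ := Finset.exists_mem_notMem_of_card_lt_card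
    (s := bad) (t := (Finset.range (N * N * d + 1)).image (Nat.cast : ℕ → ℂ)) (by
      rw [Finset.card_image_of_injective _ Nat.cast_injective, Finset.card_range]
      omega)
  obtain ⟨k, hk, rfl⟩ := Finset.mem_image.1 hx
  refine ⟨k, hk, fun t ht t' ht' heq => ?_⟩
  by_contra hne
  have hR : R (t - t') ≠ 0 := by
    intro h
    apply hne
    ext i
    have := hcoeff (t - t') i
    rw [h, Polynomial.coeff_zero] at this
    exact sub_eq_zero.1 this.symm
  apply hxb
  refine Finset.mem_biUnion.2 ⟨(t, t'), Finset.mem_product.2 ⟨ht, ht'⟩, ?_⟩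
  rw [Multiset.mem_toFinset, Polynomial.mem_roots hR, Polynomial.IsRoot, heval]
  simp only [Pi.sub_apply, mul_sub, Finset.sum_sub_distrib]
  exact sub_eq_zero.2 heq

lemma exists_generic_ncard_le {σ : Type*} {d D : ℕ} (E : (σ → ℂ) → Set (Fin d → ℂ))
    (hE : ∀ l : Fin d → ℂ, ∃ Q : Polynomial (MvPolynomial σ ℂ), Q ≠ 0 ∧ Q.natDegree ≤ D ∧
      ∀ x, ∀ t ∈ E x, (Q.map (MvPolynomial.eval x)).eval (∑ i : Fin d, l i * t i) = 0) :
    ∃ G : MvPolynomial σ ℂ, G ≠ 0 ∧ ∀ x, MvPolynomial.eval x G ≠ 0 →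
      (E x).Finite ∧ (E x).ncard ≤ D := by
  classical
  choose Q hQ0 hQdeg hQ using fun k : ℕ => hE fun i : Fin d => (k : ℂ) ^ (i : ℕ)
  refine ⟨∏ k ∈ Finset.range ((D + 1) * (D + 1) * d + 1), (Q k).leadingCoeff,
    Finset.prod_ne_zero_iff.2 fun k _ => Polynomial.leadingCoeff_ne_zero.2 (hQ0 k),
    fun x hx => ?_⟩
  rw [map_prod, Finset.prod_ne_zero_iff] at hx
  have key : ∀ s : Finset (Fin d → ℂ), ↑s ⊆ E x → s.card ≠ D + 1 := by
    intro s hs hcard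
    obtain ⟨k, hk, hinj⟩ := exists_injOn_sum_pow_mul s hcard.le
    have hne : (Q k).map (MvPolynomial.eval x) ≠ 0 := fun h => hx k hk (by
      simpa using congrArg (fun p => p.coeff (Q k).natDegree) h)
    have h1 : s.image (fun t : Fin d → ℂ => ∑ i : Fin d, (k : ℂ) ^ (i : ℕ) * t i) ⊆
        ((Q k).map (MvPolynomial.eval x)).roots.toFinset := by
      intro y hy
      obtain ⟨t, ht, rfl⟩ := Finset.mem_image.1 hy
      rw [Multiset.mem_toFinset, Polynomial.mem_roots hne]
      exact hQ k x t (hs ht)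
    have h2 := Finset.card_le_card h1
    rw [Finset.card_image_of_injOn hinj, hcard] at h2
    have h3 := (Multiset.toFinset_card_le ((Q k).map (MvPolynomial.eval x)).roots).trans
      ((Polynomial.card_roots' _).trans (Polynomial.natDegree_map_le.trans (hQdeg k)))
    omega
  have hfin : (E x).Finite := by
    by_contra hinf
    obtain ⟨s, hs, hcard⟩ := Set.Infinite.exists_subset_card_eq hinf (D + 1)
    exact key s hs hcard
  refine ⟨hfin, ?_⟩
  by_contra! hlt
  obtain ⟨s, hs, hcard⟩ := Finset.exists_subset_card_eq (s := hfin.toFinset) (n := D + 1) (by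
    rw [← Set.ncard_eq_toFinset_card _ hfin]; omega)
  exact key s (fun t ht => hfin.mem_toFinset.1 (hs ht)) hcard

/-- The points of the fibre over `w` of the rational map `t ↦ P(c, t) / q(c, t)`. -/
def rationalFiber {α β : Type*} (P : β → MvPolynomial (α ⊕ β) ℂ) (q : MvPolynomial (α ⊕ β) ℂ)
    (c : α → ℂ) (w : β → ℂ) : Set (β → ℂ) :=
  {t | MvPolynomial.eval (Sum.elim c t) q ≠ 0 ∧ ∀ i, MvPolynomial.eval (Sum.elim c t) (P i) =
    w i * MvPolynomial.eval (Sum.elim c t) q}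

open Filter Topology in
lemma exists_rationalFiber_ncard {α : Type} [Fintype α] {d : ℕ}
    (P : Fin d → MvPolynomial (α ⊕ Fin d) ℂ) {q : MvPolynomial (α ⊕ Fin d) ℂ} (hq : q ≠ 0) :
    ∃ (D : ℕ) (H : MvPolynomial (α ⊕ Fin d) ℂ), H ≠ 0 ∧
      (∀ c w, MvPolynomial.eval (Sum.elim c w) H ≠ 0 →
        (rationalFiber P q c w).Finite ∧ (rationalFiber P q c w).ncard = D) ∧
      ∀ c, ∃ G : MvPolynomial (Fin d) ℂ, G ≠ 0 ∧ ∀ w, MvPolynomial.eval w G ≠ 0 →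
        (rationalFiber P q c w).Finite ∧ (rationalFiber P q c w).ncard ≤ D := by
  classical
  let R := MvPolynomial (α ⊕ Fin d) ℂ
  let S := Localization.Away q
  have hpow : Submonoid.powers q ≤ nonZeroDivisors R :=
    powers_le_nonZeroDivisors_of_noZeroDivisors hq
  have : IsDomain S := IsLocalization.isDomain_localization hpow
  have hinj : Function.Injective (algebraMap R S) := IsLocalization.injective S hpow
  have : FaithfulSMul R S := (faithfulSMul_iff_algebraMap_injective _ _).2 hinj
  have : Algebra.FiniteType R S := 
    IsLocalization.finiteType_of_monoid_fg (Submonoid.powers q) S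
  have : Algebra.FiniteType ℂ S := Algebra.FiniteType.trans (S := R) inferInstance inferInstance
  have htr : Algebra.trdeg ℂ S ≤ Cardinal.mk (α ⊕ Fin d) := by
    have : Algebra.IsAlgebraic R S := IsLocalization.isAlgebraic S (Submonoid.powers q)
    rw [← trdeg_add_eq ℂ R (A := S), trdeg_eq_zero_iff.2 this, MvPolynomial.trdeg_of_isDomain,
      Cardinal.lift_id, add_zero]
  let qi : S := IsLocalization.Away.invSelf q
  have hqi : algebraMap R S q * qi = 1 := IsLocalization.Away.mul_invSelf q
  let φ : R →ₐ[ℂ] S := MvPolynomial.aeval (Sum.elim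
    (fun a => algebraMap R S (MvPolynomial.X (Sum.inl a))) (fun i => algebraMap R S (P i) * qi))
  have hφinl : ∀ a, φ (MvPolynomial.X (Sum.inl a)) = algebraMap R S (MvPolynomial.X (Sum.inl a)) :=
    fun a => MvPolynomial.aeval_X _ _
  have hφinr : ∀ i, φ (MvPolynomial.X (Sum.inr i)) * algebraMap R S q = algebraMap R S (P i) := by
    intro i
    have h1 : φ (MvPolynomial.X (Sum.inr i)) = algebraMap R S (P i) * qi :=
      MvPolynomial.aeval_X _ _
    rw [h1, mul_assoc, mul_comm qi, hqi, mul_one]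
  have hφC : ∀ r, φ (MvPolynomial.C r) = algebraMap R S (MvPolynomial.C r) := by
    intro r
    rw [← MvPolynomial.algebraMap_eq, AlgHom.commutes, ← IsScalarTower.algebraMap_apply ℂ R S]
  obtain ⟨D, hann, h, hh0, hspec⟩ := exists_generic_degree htr φ
  let W (t : Fin d → ℂ) (c : α → ℂ) : Fin d → ℂ := fun i =>
    MvPolynomial.eval (Sum.elim c t) (P i) / MvPolynomial.eval (Sum.elim c t) q
  have hW : ∀ c w, ∀ t ∈ rationalFiber P q c w, W t c = w := by
    intro c w t ht
    ext i
    rw [div_eq_iff ht.1, ht.2 i]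
  have hQ : ∀ l : Fin d → ℂ, ∃ Q : Polynomial R, Q ≠ 0 ∧ Q.natDegree ≤ D ∧
      ∀ c t, MvPolynomial.eval (Sum.elim c t) q ≠ 0 →
        (Q.map (MvPolynomial.eval (Sum.elim c (W t c)))).eval (∑ i, l i * t i) = 0 := by
    intro l
    obtain ⟨Q, hQ0, hQdeg, hQ⟩ := hann (algebraMap R S
      (∑ i, MvPolynomial.C (l i) * MvPolynomial.X (Sum.inr i)))
    refine ⟨Q, hQ0, hQdeg, fun c t hct => ?_⟩
    let ev : S →+* ℂ := IsLocalization.Away.lift q (g := MvPolynomial.eval (Sum.elim c t))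
      (isUnit_iff_ne_zero.2 hct)
    have hev : ∀ r, ev (algebraMap R S r) = MvPolynomial.eval (Sum.elim c t) r :=
      fun r => IsLocalization.Away.lift_eq q _ r
    have hevφ : ev.comp (φ : R →+* S) = MvPolynomial.eval (Sum.elim c (W t c)) := by
      refine MvPolynomial.ringHom_ext (fun r => ?_) ?_
      · simp [hφC, hev]
      · rintro (a | i)
        · simp [hφinl, hev]
        · have h1 := congrArg ev (hφinr i)
          rw [map_mul, hev, hev] at h1
          simpa [W, eq_div_iff hct] using h1
    have h1 := congrArg ev hQ
    rw [Polynomial.hom_eval₂, hevφ, hev, map_zero] at h1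
    rw [Polynomial.eval_map]
    simpa using h1
  obtain ⟨G₁, hG₁, hG₁'⟩ := exists_generic_ncard_le
    (fun x : α ⊕ Fin d → ℂ => rationalFiber P q (x ∘ Sum.inl) (x ∘ Sum.inr)) (D := D) (by
      intro l
      obtain ⟨Q, hQ0, hQdeg, hQ⟩ := hQ l
      refine ⟨Q, hQ0, hQdeg, fun x t ht => ?_⟩
      have := hQ (x ∘ Sum.inl) t ht.1
      rwa [hW _ _ t ht, Sum.elim_comp_inl_inr] at this)
  refine ⟨D, G₁ * h, mul_ne_zero hG₁ hh0, fun c w hcw => ?_, fun c => ?_⟩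
  · rw [map_mul] at hcw
    obtain ⟨hfin, hle⟩ := hG₁' (Sum.elim c w) (left_ne_zero_of_mul hcw)
    simp only [Sum.elim_comp_inl, Sum.elim_comp_inr] at hfin hle
    refine ⟨hfin, le_antisymm hle ?_⟩
    obtain ⟨s, hcard, hs⟩ := hspec (MvPolynomial.eval (Sum.elim c w)) (right_ne_zero_of_mul hcw)
    let τ (χ : S →+* ℂ) : Fin d → ℂ := fun i => χ (algebraMap R S (MvPolynomial.X (Sum.inr i)))
    have hs' : ∀ χ ∈ s, ∀ r, χ (φ r) = MvPolynomial.eval (Sum.elim c w) r := fun χ hχ r =>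
      RingHom.congr_fun (hs χ hχ) r
    have hχ : ∀ χ ∈ s, χ.comp (algebraMap R S) = MvPolynomial.eval (Sum.elim c (τ χ)) := by
      intro χ hχ
      refine MvPolynomial.ringHom_ext (fun r => ?_) ?_
      · rw [RingHom.comp_apply, ← hφC, hs' χ hχ, MvPolynomial.eval_C, MvPolynomial.eval_C]
      · rintro (a | i)
        · rw [RingHom.comp_apply, ← hφinl, hs' χ hχ]
          simp
        · simp [τ]
    have hχ' : ∀ χ ∈ s, ∀ r, χ (algebraMap R S r) = MvPolynomial.eval (Sum.elim c (τ χ)) r :=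
      fun χ h r => RingHom.congr_fun (hχ χ h) r
    have hinjOn : Set.InjOn τ s := by
      intro χ₁ h₁ χ₂ h₂ heq
      refine IsLocalization.ringHom_ext (Submonoid.powers q) ?_
      rw [hχ χ₁ h₁, hχ χ₂ h₂, heq]
    rw [← hcard, ← Finset.card_image_of_injOn hinjOn, ← Set.ncard_coe_finset]
    refine Set.ncard_le_ncard ?_ hfin
    intro t ht
    obtain ⟨χ, hχs, rfl⟩ := Finset.mem_image.1 (Finset.mem_coe.1 ht)
    refine ⟨fun h0 => ?_, fun i => ?_⟩
    · have := congrArg χ hqi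
      rw [map_mul, hχ' χ hχs, h0, zero_mul, map_one] at this
      exact zero_ne_one this
    · rw [← hχ' χ hχs, ← hχ' χ hχs, ← hφinr, map_mul, hs' χ hχs]
      simp
  · refine exists_generic_ncard_le (rationalFiber P q c) fun l => ?_
    obtain ⟨Q, hQ0, hQdeg, hQ⟩ := hQ l
    obtain ⟨Q₀, hQ₀, hQ₀deg, hQ₀'⟩ := exists_specialized_polynomial hQ0 c
    refine ⟨Q₀, hQ₀, hQ₀deg.trans hQdeg, fun w t ht => ?_⟩
    have hcont : ∀ p : R, Continuous fun c' : α → ℂ => MvPolynomial.eval (Sum.elim c' t) p := by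
      intro p
      refine (MvPolynomial.continuous_eval p).comp (continuous_pi ?_)
      rintro (a | i)
      · exact continuous_apply a
      · exact continuous_const
    have hWc : ContinuousAt (W t) c :=
      continuousAt_pi.2 fun i => (hcont _).continuousAt.div (hcont _).continuousAt ht.1
    have := hQ₀' (W t) (∑ i, l i * t i) hWc (by
      filter_upwards [(hcont q).continuousAt.eventually_ne ht.1] with c' hc'
      exact hQ c' t hc')
    rwa [hW c w t ht] at this

lemma exists_lattice_factorization {m n : Type} [Fintype m] [Fintype n] [DecidableEq m]
    [DecidableEq n] (A : Matrix m n ℤ) :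
    ∃ (d : ℕ) (B : Matrix (Fin d) n ℤ) (F : Matrix n (Fin d) ℤ) (E : Matrix m (Fin d) ℤ)
      (Z : Matrix (Fin d) m ℚ), A = E * B ∧ B * F = 1 ∧ Z * E.map (Int.cast : ℤ → ℚ) = 1 := by
  classical
  let L := LinearMap.range A.mulVecLin
  let e := Module.finBasis ℤ L
  have hF : ∀ k, ∃ f : n → ℤ, A.mulVec f = (e k : m → ℤ) := fun k => (e k).2
  choose f hf using hF
  let E : Matrix m (Fin (Module.finrank ℤ L)) ℤ := Matrix.of fun i k => (e k : m → ℤ) i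
  let B : Matrix (Fin (Module.finrank ℤ L)) n ℤ :=
    Matrix.of fun k j => e.repr (A.mulVecLin.rangeRestrict (Pi.single j 1)) k
  have hE : ∀ x, E.mulVec x = ((∑ k, x k • e k : L) : m → ℤ) := by
    intro x
    ext i
    simp [E, Matrix.mulVec, dotProduct, Finset.sum_apply, mul_comm]
  have hEinj : Function.Injective E.mulVec := by
    intro x y hxy
    rw [hE, hE] at hxy
    have := congrArg e.repr (Subtype.ext hxy)
    ext k
    simpa [Finsupp.single_apply] using DFunLike.congr_fun this k
  have hAEB : A = E * B := by
    ext i j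
    have h1 := congrFun (hE fun k => B k j) i
    have h2 : (∑ k, B k j • e k : L) = A.mulVecLin.rangeRestrict (Pi.single j 1) :=
      e.sum_repr _
    rw [h2] at h1
    rw [Matrix.mul_apply]
    simpa [Matrix.mulVec, dotProduct, Pi.single_apply] using h1.symm
  refine ⟨_, B, Matrix.of fun j k => f k j, E, ?_⟩
  have hBF : B * (Matrix.of fun j k => f k j) = 1 := by
    refine Matrix.ext_of_mulVec_single fun k => hEinj ?_
    rw [Matrix.mulVec_mulVec, ← Matrix.mul_assoc, ← hAEB, ← Matrix.mulVec_mulVec]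
    have : (Matrix.of fun j k => f k j).mulVec (Pi.single k 1) = f k := by
      ext j; simp
    rw [this, hf, hE]
    simp [Matrix.one_apply]
  have hEQ : Function.Injective (E.map (Int.cast : ℤ → ℚ)).mulVecLin := by
    have hli : LinearIndependent ℤ E.col := by
      rw [← Matrix.mulVec_injective_iff]
      exact hEinj
    have hli' : LinearIndependent ℤ (E.map (Int.cast : ℤ → ℚ)).col :=
      hli.map' ((Int.castAddHom ℚ).compLeft m).toIntLinearMap <| LinearMap.ker_eq_bot.2 fun x y h =>
        funext fun i => Int.cast_injective (α := ℚ) (congrFun h i)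
    exact Matrix.mulVec_injective_iff.2 ((LinearIndependent.iff_fractionRing ℤ ℚ).1 hli')
  obtain ⟨g, hg⟩ := LinearMap.exists_leftInverse_of_injective _ (LinearMap.ker_eq_bot.2 hEQ)
  refine ⟨LinearMap.toMatrix' g, hAEB, hBF, ?_⟩
  have h := congrArg LinearMap.toMatrix' hg
  rwa [LinearMap.toMatrix'_comp, ← Matrix.toLin'_apply', LinearMap.toMatrix'_toLin',
    LinearMap.toMatrix'_id] at h

lemma exists_row_lattice_basis {r n : ℕ} (A : Fin r → Fin n → ℤ) :
    ∃ (d : ℕ) (B : Matrix (Fin d) (Fin n) ℤ) (F : Matrix (Fin n) (Fin d) ℤ), B * F = 1 ∧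
      ∀ x : Fin n → ℂ, (B.map (Int.cast : ℤ → ℂ)).mulVec x = 0 ↔
        (∀ i, ∑ j, (A i j : ℂ) * x j = 0) ∧ ∑ j, x j = 0 := by
  obtain ⟨d, B, F, E, Z, hA, hBF, hZ⟩ :=
    exists_lattice_factorization (Matrix.of fun i : Option (Fin r) => i.elim (fun _ => 1) A)
  refine ⟨d, B, F, hBF, fun x => ?_⟩
  have hA' : (Matrix.of fun i : Option (Fin r) => i.elim (fun _ => 1) A).map
      (Int.cast : ℤ → ℂ) = E.map (Int.cast : ℤ → ℂ) * B.map (Int.cast : ℤ → ℂ) := by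
    rw [hA]
    exact Matrix.map_mul (f := Int.castRingHom ℂ)
  have hZ' : Z.map (Rat.cast : ℚ → ℂ) * E.map (Int.cast : ℤ → ℂ) = 1 := by
    have h := congrArg (fun M => M.map (Rat.castHom ℂ)) hZ
    simp only [Matrix.map_mul, Matrix.map_map] at h
    rw [Matrix.map_one _ (map_zero _) (map_one _)] at h
    have hcast : Rat.castHom ℂ ∘ Int.cast = (Int.cast : ℤ → ℂ) := by ext; simp
    rwa [hcast] at h
  have hiff : (B.map (Int.cast : ℤ → ℂ)).mulVec x = 0 ↔
      ((Matrix.of fun i : Option (Fin r) => i.elim (fun _ => 1) A).map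
        (Int.cast : ℤ → ℂ)).mulVec x = 0 := by
    rw [hA', ← Matrix.mulVec_mulVec]
    refine ⟨fun h => by rw [h, Matrix.mulVec_zero], fun h => ?_⟩
    have := congrArg (Z.map (Rat.cast : ℚ → ℂ)).mulVec h
    rwa [Matrix.mulVec_mulVec, hZ', Matrix.one_mulVec, Matrix.mulVec_zero] at this
  rw [hiff, funext_iff, Option.forall, and_comm]
  simp [Matrix.mulVec, dotProduct]

lemma prod_zpow_sum {ι κ : Type*} [Fintype ι] [Fintype κ] {x : ι → ℂ} (hx : ∀ i, x i ≠ 0)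
    (M : Matrix ι κ ℤ) (v : κ → ℤ) :
    ∏ j, (∏ i, x i ^ M i j) ^ v j = ∏ i, x i ^ (∑ j, M i j * v j) := by
  simp_rw [← Finset.prod_zpow, ← zpow_mul]
  rw [Finset.prod_comm]
  refine Finset.prod_congr rfl fun i _ => ?_
  classical
  induction (Finset.univ : Finset κ) using Finset.induction with
  | empty => simp
  | insert j s hj ih => rw [Finset.prod_insert hj, Finset.sum_insert hj, zpow_add₀ (hx i), ih]

lemma prod_pow_toNat_eq_iff {ι : Type*} [Fintype ι] {p : ι → ℂ} (hp : ∀ j, p j ≠ 0)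
    (v : ι → ℤ) :
    ∏ j, p j ^ (max (v j) 0).toNat = ∏ j, p j ^ (max (-v j) 0).toNat ↔ ∏ j, p j ^ v j = 1 := by
  have h : ∏ j, p j ^ (max (v j) 0).toNat =
      (∏ j, p j ^ v j) * ∏ j, p j ^ (max (-v j) 0).toNat := by
    rw [← Finset.prod_mul_distrib]
    refine Finset.prod_congr rfl fun j _ => ?_
    rw [← zpow_natCast, ← zpow_natCast, ← zpow_add₀ (hp j)]
    congr 1
    omega
  rw [h, mul_eq_right₀]
  exact Finset.prod_ne_zero_iff.2 fun j _ => pow_ne_zero _ (hp j)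

lemma exists_rationalFiber_eq {d : ℕ} {n : ℕ} (B : Matrix (Fin d) (Fin n) ℤ) :
    ∃ (P : Fin d → MvPolynomial (Fin n ⊕ Fin d) ℂ) (q : MvPolynomial (Fin n ⊕ Fin d) ℂ), q ≠ 0 ∧
      ∀ c w, rationalFiber P q c w = {t | (∀ k, t k ≠ 0) ∧
        ∀ k, ∑ j, (B k j : ℂ) * (c j * ∏ l, t l ^ B l j) = w k} := by
  let m : ℕ := 1 + ∑ l, ∑ j, (B l j).natAbs
  have hm : ∀ l j, (((B l j + m).toNat : ℕ) : ℤ) = B l j + m := by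
    intro l j
    have h1 : (B l j).natAbs ≤ ∑ j, (B l j).natAbs :=
      Finset.single_le_sum (f := fun j => (B l j).natAbs) (fun _ _ => Nat.zero_le _)
        (Finset.mem_univ j)
    have h2 : ∑ j, (B l j).natAbs ≤ ∑ l, ∑ j, (B l j).natAbs :=
      Finset.single_le_sum (f := fun l => ∑ j, (B l j).natAbs) (fun _ _ => Nat.zero_le _)
        (Finset.mem_univ l)
    omega
  refine ⟨fun k => ∑ j, MvPolynomial.C (B k j : ℂ) * (MvPolynomial.X (Sum.inl j) *
    ∏ l, MvPolynomial.X (Sum.inr l) ^ (B l j + m).toNat),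
    (∏ l, MvPolynomial.X (Sum.inr l)) ^ m,
    pow_ne_zero _ (Finset.prod_ne_zero_iff.2 fun l _ => MvPolynomial.X_ne_zero _), fun c w => ?_⟩
  ext t
  simp only [rationalFiber, Set.mem_ofPred_eq, map_pow, map_prod, MvPolynomial.eval_X,
    Sum.elim_inr, Sum.elim_inl, map_sum, map_mul, MvPolynomial.eval_C]
  have hq : (∏ l, t l) ^ m ≠ 0 ↔ ∀ k, t k ≠ 0 := by
    rw [pow_ne_zero_iff (by omega), Finset.prod_ne_zero_iff]
    simp
  rw [hq]
  refine and_congr_right fun ht => forall_congr' fun k => ?_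
  have hmon : ∀ j, ∏ l, t l ^ (B l j + m).toNat = (∏ l, t l ^ B l j) * (∏ l, t l) ^ m := by
    intro j
    rw [← Finset.prod_pow, ← Finset.prod_mul_distrib]
    refine Finset.prod_congr rfl fun l _ => ?_
    rw [← zpow_natCast, hm, zpow_add₀ (ht l), zpow_natCast]
  simp_rw [hmon, ← mul_assoc, ← Finset.sum_mul]
  exact mul_left_inj' (hq.2 ht)

lemma mlSolutions_finite_iff_and_ncard_eq {r n d : ℕ} {A : Fin r → Fin n → ℤ}
    {B : Matrix (Fin d) (Fin n) ℤ} {F : Matrix (Fin n) (Fin d) ℤ} (hBF : B * F = 1)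
    (hB : ∀ x : Fin n → ℂ, (B.map (Int.cast : ℤ → ℂ)).mulVec x = 0 ↔
        (∀ i, ∑ j, (A i j : ℂ) * x j = 0) ∧ ∑ j, x j = 0)
    (c u : Fin n → ℂ) (hu : ∑ j, u j ≠ 0) (T : Set (Fin d → ℂ))
    (hT : T = {t : Fin d → ℂ | (∀ k, t k ≠ 0) ∧
        ∀ k, ∑ j, (B k j : ℂ) * (c j * ∏ l, t l ^ B l j) =
          (B.map (Int.cast : ℤ → ℂ)).mulVec u k}) :
    ((mlSolutions A c u).Finite ↔ T.Finite) ∧ (mlSolutions A c u).ncard = T.ncard := by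
  subst hT
  set s := ∑ j, u j with hs
  have hBZ : ∀ v : Fin n → ℤ, (∀ k, ∑ j, B k j * v j = 0) ↔
      (∀ i, ∑ j, A i j * v j = 0) ∧ ∑ j, v j = 0 := by
    intro v
    have := hB fun j => (v j : ℂ)
    rw [funext_iff] at this
    simp only [Matrix.mulVec, dotProduct, Matrix.map_apply, Pi.zero_apply] at this
    exact_mod_cast this
  have hcond : ∀ x : Fin n → ℂ, (∀ k, ∑ j, (B k j : ℂ) * (c j * x j) =
      (B.map (Int.cast : ℤ → ℂ)).mulVec u k) ↔
      (∀ i, ∑ j, (A i j : ℂ) * (c j * x j) = ∑ j, (A i j : ℂ) * u j) ∧ ∑ j, c j * x j = s := by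
    intro x
    have := hB fun j => c j * x j - u j
    rw [funext_iff] at this
    simpa [Matrix.mulVec, dotProduct, mul_sub, Finset.sum_sub_distrib, sub_eq_zero] using this
  let Ψ : (Fin d → ℂ) → Fin n → ℂ := fun t j => s⁻¹ * ∏ l, t l ^ B l j
  have hsΨ : ∀ t j, s * Ψ t j = ∏ l, t l ^ B l j := fun t j => mul_inv_cancel_left₀ hu _
  have hΨ0 : ∀ t : Fin d → ℂ, (∀ k, t k ≠ 0) → ∀ j, ∏ l, t l ^ B l j ≠ 0 := fun t ht j =>
    Finset.prod_ne_zero_iff.2 fun l _ => zpow_ne_zero _ (ht l)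
  have hscale : ∀ (p : Fin n → ℂ) (v : Fin n → ℤ), ∑ j, v j = 0 →
      ∏ j, (s * p j) ^ v j = ∏ j, p j ^ v j := by
    intro p v hv
    simp_rw [mul_zpow]
    have := prod_zpow_sum (x := fun _ : Unit => s) (fun _ => hu) (Matrix.of fun _ _ => 1) v
    simp only [Matrix.of_apply, Finset.univ_unique, Finset.prod_singleton, zpow_one, one_mul, hv,
      zpow_zero] at this
    rw [Finset.prod_mul_distrib, this, one_mul]
  have hinj : Set.InjOn Ψ {t : Fin d → ℂ | (∀ k, t k ≠ 0) ∧
        ∀ k, ∑ j, (B k j : ℂ) * (c j * ∏ l, t l ^ B l j) =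
          (B.map (Int.cast : ℤ → ℂ)).mulVec u k} := by
    have hrec : ∀ t : Fin d → ℂ, (∀ k, t k ≠ 0) → ∀ l, ∏ j, (s * Ψ t j) ^ F j l = t l := by
      intro t ht l
      simp_rw [hsΨ]
      rw [prod_zpow_sum ht]
      simp_rw [← Matrix.mul_apply, hBF]
      rw [Finset.prod_eq_single l (fun k _ hk => by simp [hk]) (by simp)]
      simp
    intro t₁ h₁ t₂ h₂ h
    ext l
    rw [← hrec t₁ h₁.1, h, hrec t₂ h₂.1]
  have himage : mlSolutions A c u = Ψ '' {t : Fin d → ℂ | (∀ k, t k ≠ 0) ∧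
        ∀ k, ∑ j, (B k j : ℂ) * (c j * ∏ l, t l ^ B l j) =
          (B.map (Int.cast : ℤ → ℂ)).mulVec u k} := by
    ext p
    constructor
    · rintro ⟨hp, hbin, h1, hA⟩
      have hsp : ∀ j, s * p j ≠ 0 := fun j => mul_ne_zero hu (hp j)
      have hmon : ∀ j, ∏ l, (∏ i, (s * p i) ^ F i l) ^ B l j = s * p j := by
        intro j
        rw [prod_zpow_sum hsp]
        simp_rw [← Matrix.mul_apply]
        have hv := (hBZ fun i => (F * B) i j - (1 : Matrix (Fin n) (Fin n) ℤ) i j).1 (by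
          intro k
          have : (B * (F * B - 1) : Matrix (Fin d) (Fin n) ℤ) k j = 0 := by
            rw [Matrix.mul_sub, ← Matrix.mul_assoc, hBF, Matrix.one_mul, Matrix.mul_one, sub_self,
              Matrix.zero_apply]
          rwa [Matrix.mul_apply] at this)
        have h2 := (prod_pow_toNat_eq_iff hp _).1 (hbin _ hv.1 hv.2)
        rw [← hscale p _ hv.2] at h2
        simp_rw [zpow_sub₀ (hsp _)] at h2
        rw [Finset.prod_div_distrib, div_eq_one_iff_eq
          (Finset.prod_ne_zero_iff.2 fun i _ => zpow_ne_zero _ (hsp i))] at h2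
        rw [h2, Finset.prod_eq_single j (fun k _ hk => by simp [hk]) (by simp)]
        simp
      refine ⟨fun l => ∏ i, (s * p i) ^ F i l, ⟨fun k => Finset.prod_ne_zero_iff.2 fun i _ =>
        zpow_ne_zero _ (hsp i), ?_⟩, ?_⟩
      · simp_rw [hmon]
        refine (hcond fun j => s * p j).2 ⟨fun i => ?_, ?_⟩
        · rw [← hA i, Finset.mul_sum]
          exact Finset.sum_congr rfl fun j _ => by ring
        · simp_rw [mul_left_comm _ s, ← Finset.mul_sum, h1, mul_one]
      · ext j
        simp only [Ψ, hmon]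
        exact inv_mul_cancel_left₀ hu _
    · rintro ⟨t, ⟨ht, hfib⟩, rfl⟩
      have hΨ : ∀ j, Ψ t j ≠ 0 := fun j => mul_ne_zero (inv_ne_zero hu) (hΨ0 t ht j)
      obtain ⟨h1, h2⟩ := (hcond _).1 hfib
      simp_rw [← hsΨ] at h1 h2
      refine ⟨hΨ, fun v hv hv0 => ?_, mul_left_cancel₀ hu ?_, fun i => ?_⟩
      · rw [prod_pow_toNat_eq_iff hΨ, ← hscale _ _ hv0]
        simp_rw [hsΨ]
        rw [prod_zpow_sum ht]
        exact Finset.prod_eq_one fun l _ => by rw [(hBZ v).2 ⟨hv, hv0⟩ l, zpow_zero]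
      · simpa only [mul_left_comm _ s, ← Finset.mul_sum, mul_one] using h2
      · rw [← h1 i, Finset.mul_sum]
        exact Finset.sum_congr rfl fun j _ => by ring
  rw [himage]
  exact ⟨Set.finite_image_iff hinj, hinj.ncard_image⟩

/-- For a generic pair `(c,u)` the likelihood system has exactly `D` solutions,
and for every fixed scaling `c` and generic `u` it has at most `D` solutions:
the ML degree of `V^c` is at most `deg V`, with equality for generic `c`. -/
theorem ml_degree_at_most_degree
    (r n : ℕ) (hr : 0 < r) (hn : 0 < n) (A : Fin r → Fin n → ℤ) :
    ∃ (D : ℕ) (H : MvPolynomial (Fin n ⊕ Fin n) ℂ), H ≠ 0 ∧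
      (∀ c u : Fin n → ℂ, (∀ j, c j ≠ 0) →
        MvPolynomial.eval (Sum.elim c u) H ≠ 0 →
        (mlSolutions A c u).Finite ∧ (mlSolutions A c u).ncard = D) ∧
      (∀ c : Fin n → ℂ, (∀ j, c j ≠ 0) →
        ∃ G : MvPolynomial (Fin n) ℂ, G ≠ 0 ∧
          ∀ u : Fin n → ℂ, MvPolynomial.eval u G ≠ 0 →
            (mlSolutions A c u).Finite ∧ (mlSolutions A c u).ncard ≤ D) := by
  obtain ⟨d, B, F, hBF, hB⟩ := exists_row_lattice_basis A
  obtain ⟨P, q, hq, hPq⟩ := exists_rationalFiber_eq B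
  obtain ⟨D, H, hH, hgen, hfix⟩ := exists_rationalFiber_ncard P hq
  have hBFC : B.map (Int.cast : ℤ → ℂ) * F.map (Int.cast : ℤ → ℂ) = 1 := by
    have h := congrArg (fun M => M.map (Int.castRingHom ℂ)) hBF
    simp only [Matrix.map_mul] at h
    rwa [Matrix.map_one _ (map_zero _) (map_one _)] at h
  have hsurj : ∀ w : Fin d → ℂ, ∃ u : Fin n → ℂ, (B.map (Int.cast : ℤ → ℂ)).mulVec u = w :=
    fun w => ⟨(F.map (Int.cast : ℤ → ℂ)).mulVec w, by
      rw [Matrix.mulVec_mulVec, hBFC, Matrix.one_mulVec]⟩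
  have hfib : ∀ c u : Fin n → ℂ, ∑ j, u j ≠ 0 →
      ((mlSolutions A c u).Finite ↔
        (rationalFiber P q c ((B.map (Int.cast : ℤ → ℂ)).mulVec u)).Finite) ∧
      (mlSolutions A c u).ncard =
        (rationalFiber P q c ((B.map (Int.cast : ℤ → ℂ)).mulVec u)).ncard :=
    fun c u hu => mlSolutions_finite_iff_and_ncard_eq hBF hB c u hu _ (hPq _ _)
  have hsum : ∀ {σ : Type} (f : Fin n → σ), Function.Injective f →
      ∑ j, (MvPolynomial.X (f j) : MvPolynomial σ ℂ) ≠ 0 := by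
    intro σ f hf h
    classical
    have := congrArg (MvPolynomial.eval (Pi.single (f ⟨0, hn⟩) (1 : ℂ))) h
    simp [Pi.single_apply, hf.eq_iff] at this
  have heval : ∀ c u : Fin n → ℂ, MvPolynomial.eval (Sum.elim c u) (MvPolynomial.bind₁ (Sum.elim
      (fun j => MvPolynomial.X (Sum.inl j)) fun k =>
        ∑ j, MvPolynomial.C (B k j : ℂ) * MvPolynomial.X (Sum.inr j)) H) =
      MvPolynomial.eval (Sum.elim c ((B.map (Int.cast : ℤ → ℂ)).mulVec u)) H := by
    intro c u
    refine (MvPolynomial.eval₂Hom_bind₁ (RingHom.id ℂ) _ _ H).trans ?_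
    change MvPolynomial.eval _ _ = _
    congr 2
    ext (j | k)
    · simp
    · simp [Matrix.mulVec, dotProduct]
  refine ⟨D, MvPolynomial.bind₁ (Sum.elim (fun j => MvPolynomial.X (Sum.inl j)) fun k =>
    ∑ j, MvPolynomial.C (B k j : ℂ) * MvPolynomial.X (Sum.inr j)) H *
      ∑ j, MvPolynomial.X (Sum.inr j), ?_, ?_, ?_⟩
  · refine mul_ne_zero (fun h0 => hH (MvPolynomial.funext fun x => ?_)) (hsum _ Sum.inr_injective)
    obtain ⟨u, hu⟩ := hsurj (x ∘ Sum.inr)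
    have := congrArg (MvPolynomial.eval (Sum.elim (x ∘ Sum.inl) u)) h0
    rwa [heval, hu, Sum.elim_comp_inl_inr, map_zero] at this
  · intro c u _ hcu
    rw [map_mul, heval] at hcu
    obtain ⟨hfin, hcard⟩ := hfib c u (by simpa using right_ne_zero_of_mul hcu)
    rw [hfin, hcard]
    exact hgen c _ (left_ne_zero_of_mul hcu)
  · intro c _
    obtain ⟨G, hG, hGle⟩ := hfix c
    have hevalG : ∀ u, MvPolynomial.eval u (MvPolynomial.bind₁ (fun k => ∑ j,
        MvPolynomial.C (B k j : ℂ) * MvPolynomial.X j) G) =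
          MvPolynomial.eval ((B.map (Int.cast : ℤ → ℂ)).mulVec u) G := by
      intro u
      refine (MvPolynomial.eval₂Hom_bind₁ (RingHom.id ℂ) _ _ G).trans ?_
      change MvPolynomial.eval _ _ = _
      congr 2
      ext k
      simp [Matrix.mulVec, dotProduct]
    refine ⟨MvPolynomial.bind₁ (fun k => ∑ j,
      MvPolynomial.C (B k j : ℂ) * MvPolynomial.X j) G * ∑ j, MvPolynomial.X j,
      mul_ne_zero (fun h0 => hG (MvPolynomial.funext fun w => ?_))
        (hsum _ Function.injective_id), fun u hu => ?_⟩
    · obtain ⟨u, rfl⟩ := hsurj w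
      rw [← hevalG, h0, map_zero, map_zero]
    · rw [map_mul, hevalG] at hu
      obtain ⟨hfin, hcard⟩ := hfib c u (by simpa using right_ne_zero_of_mul hu)
      rw [hfin, hcard]
      exact hGle _ (left_ne_zero_of_mul hu)
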